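/- arXiv:1903.01696 — 12 statements merged into one kernel-verified Lean document; each statement's English description precedes it below -/
import Mathlib

section
/- Fix ψ* ∈ Ψ and let R(ψ*) = {x ∈ 𝒳 : m_{ψ*}(x) ≤ m(x)} be the set of data not giving evidence in favor of ψ* under the principle of evidence. Then for every measurable set D ⊆ 𝒳 satisfying M_{ψ*}(D) ≤ M_{ψ*}(R(ψ*)), one has M(D) ≤ M(R(ψ*)). That is, among all rules for declaring 'no evidence in favor of ψ*' whose conditional prior predictive probability under ψ* is at most that of the principle of evidence, the principle-of-evidence region R(ψ*) maximizes the prior predictive probability M(D). -/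
open MeasureTheory
open scoped ENNReal

/-- Neyman–Pearson inequality for the region where `f ≤ g`: it has the largest `g`-mass among
the measurable sets whose `f`-mass does not exceed its own. -/
theorem withDensity_apply_le_of_withDensity_apply_le_setOf_le
    {X : Type*} [MeasurableSpace X] (μ : Measure X) {f g : X → ℝ≥0∞}
    (hf : Measurable f) (hg : Measurable g) [IsFiniteMeasure (μ.withDensity f)]
    {D : Set X} (hD : MeasurableSet D)
    (hle : μ.withDensity f D ≤ μ.withDensity f {x | f x ≤ g x}) :
    μ.withDensity g D ≤ μ.withDensity g {x | f x ≤ g x} := by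
  set R : Set X := {x | f x ≤ g x}
  have hR : MeasurableSet R := measurableSet_le hf hg
  have h_diff : μ.withDensity f (D \ R) ≤ μ.withDensity f (R \ D) := by
    rw [← measure_inter_add_sdiff D hR, ← measure_inter_add_sdiff R hD, Set.inter_comm R D] at hle
    exact (ENNReal.add_le_add_iff_left (measure_ne_top _ _)).mp hle
  have h_out : μ.withDensity g (D \ R) ≤ μ.withDensity f (D \ R) := by
    rw [withDensity_apply _ (hD.diff hR), withDensity_apply _ (hD.diff hR)]
    exact setLIntegral_mono hf fun x hx => (not_le.mp hx.2).le
  have h_in : μ.withDensity f (R \ D) ≤ μ.withDensity g (R \ D) := by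
    rw [withDensity_apply _ (hR.diff hD), withDensity_apply _ (hR.diff hD)]
    exact setLIntegral_mono hg fun x hx => hx.1
  rw [← measure_inter_add_sdiff D hR, ← measure_inter_add_sdiff R hD, Set.inter_comm R D]
  gcongr _ + ?_
  exact h_out.trans (h_diff.trans h_in)

/-- **Theorem 1(i)** (Evans–Guo): among all rules `D` for declaring "no evidence in favor of
`ψ*`" whose conditional prior predictive probability under `ψ*` is at most that of the
principle-of-evidence region `R(ψ*) = {x | m_{ψ*}(x) ≤ m(x)}`, the region `R(ψ*)` maximizes
the prior predictive probability `M(D)`. -/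
theorem principle_of_evidence_maximizes_prior_prob_no_evidence_in_favor
    {X Ψ : Type*} [MeasurableSpace X] [MeasurableSpace Ψ]
    (μ : Measure X) [SigmaFinite μ]
    (Pr : Measure Ψ) [IsProbabilityMeasure Pr]
    (m : Ψ → X → ℝ≥0∞) (hm : Measurable (Function.uncurry m))
    (hprob : ∀ ψ, IsProbabilityMeasure (μ.withDensity (m ψ)))
    (mbar : X → ℝ≥0∞) (hmbar : ∀ x, mbar x = ∫⁻ ψ, m ψ x ∂Pr)
    (ψs : Ψ) (D : Set X) (hD : MeasurableSet D)
    (hle : μ.withDensity (m ψs) D ≤ μ.withDensity (m ψs) {x | m ψs x ≤ mbar x}) :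
    μ.withDensity mbar D ≤ μ.withDensity mbar {x | m ψs x ≤ mbar x} := by
  have := hprob ψs
  have h_mbar : Measurable mbar := by
    rw [funext hmbar]
    exact hm.lintegral_prod_left'
  exact withDensity_apply_le_of_withDensity_apply_le_setOf_le μ (f := m ψs)
    (hm.comp measurable_prodMk_left) h_mbar hD hle
end

section
/- Fix ψ* ∈ Ψ and let R(ψ*) = {x ∈ 𝒳 : m_{ψ*}(x) ≤ m(x)}. (i) If Π({ψ*}) = 0, then for every measurable set D ⊆ 𝒳 with M_{ψ*}(D) ≤ M_{ψ*}(R(ψ*)), one has ∫_{Ψ∖{ψ*}} M_ψ(D) Π(dψ) ≤ ∫_{Ψ∖{ψ*}} M_ψ(R(ψ*)) Π(dψ); that is, R(ψ*) maximizes the prior probability of not obtaining evidence in favor of ψ* when ψ* is false. (ii) For an arbitrary prior Π, the same inequality ∫_{Ψ∖{ψ*}} M_ψ(D) Π(dψ) ≤ ∫_{Ψ∖{ψ*}} M_ψ(R(ψ*)) Π(dψ) holds for every measurable D satisfying M_{ψ*}(D) = M_{ψ*}(R(ψ*)). -/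
open MeasureTheory
open scoped ENNReal

/-- The complement of a non-measurable singleton has full outer measure in every measurable set. -/
theorem MeasureTheory.Measure.restrict_compl_singleton_of_not_measurableSet
    {α : Type*} [MeasurableSpace α] (ν : Measure α) {a : α} (ha : ¬ MeasurableSet {a}) :
    ν.restrict {a}ᶜ = ν := by
  ext t ht
  rw [Measure.restrict_apply ht]
  refine le_antisymm (measure_mono Set.inter_subset_left) ?_
  rw [← measure_toMeasurable (μ := ν) (t ∩ {a}ᶜ)]
  refine measure_mono fun x hx => ?_
  have hsub := subset_toMeasurable ν (t ∩ {a}ᶜ)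
  by_cases hxa : x = a
  · subst hxa
    by_contra hxu
    refine ha ?_
    have : {x} = t \ toMeasurable ν (t ∩ {x}ᶜ) := by
      ext y
      constructor
      · rintro rfl
        exact ⟨hx, hxu⟩
      · rintro ⟨hy, hyu⟩
        by_contra hne
        exact hyu (hsub ⟨hy, hne⟩)
    rw [this]
    exact ht.diff (measurableSet_toMeasurable _ _)
  · exact hsub ⟨hx, hxa⟩

/-- A Neyman–Pearson type inequality for the region `{x | f x ≤ g x}`. -/
theorem MeasureTheory.setLIntegral_le_setLIntegral_setOf_le
    {α : Type*} [MeasurableSpace α] {μ : Measure α} {f g : α → ℝ≥0∞}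
    (hf : Measurable f) (hg : Measurable g) {D : Set α} (hD : MeasurableSet D)
    (hfin : ∫⁻ x in D, f x ∂μ ≠ ∞)
    (h : ∫⁻ x in D, f x ∂μ ≤ ∫⁻ x in {x | f x ≤ g x}, f x ∂μ) :
    ∫⁻ x in D, g x ∂μ ≤ ∫⁻ x in {x | f x ≤ g x}, g x ∂μ := by
  have hR : MeasurableSet {x | f x ≤ g x} := measurableSet_le hf hg
  set R := {x | f x ≤ g x}
  have hinter : ∫⁻ x in D ∩ R, f x ∂μ ≠ ∞ :=
    ne_top_of_le_ne_top hfin (lintegral_mono_set Set.inter_subset_left)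
  have hdiff : ∫⁻ x in D \ R, f x ∂μ ≤ ∫⁻ x in R \ D, f x ∂μ := by
    rw [← lintegral_inter_add_sdiff f D hR, ← lintegral_inter_add_sdiff f R hD,
      Set.inter_comm R D] at h
    exact (ENNReal.add_le_add_iff_left hinter).1 h
  rw [← lintegral_inter_add_sdiff g D hR, ← lintegral_inter_add_sdiff g R hD, Set.inter_comm R D]
  refine add_le_add_right ?_ _
  calc ∫⁻ x in D \ R, g x ∂μ
      ≤ ∫⁻ x in D \ R, f x ∂μ := setLIntegral_mono hf fun x hx => (not_le.1 hx.2).le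
    _ ≤ ∫⁻ x in R \ D, f x ∂μ := hdiff
    _ ≤ ∫⁻ x in R \ D, g x ∂μ := setLIntegral_mono hg fun x hx => hx.1

/-- **Theorem 1(ii)** (Evans–Guo): the principle-of-evidence region
`R(ψ*) = {x | m_{ψ*}(x) ≤ m(x)}` maximizes the prior probability of not obtaining
evidence in favor of `ψ*` when it is false: (i) when `Π({ψ*}) = 0`, among all rules `D`
with `M_{ψ*}(D) ≤ M_{ψ*}(R(ψ*))`; (ii) for arbitrary priors, among all rules `D` with
`M_{ψ*}(D) = M_{ψ*}(R(ψ*))`. -/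
theorem principle_of_evidence_maximizes_prob_no_evidence_in_favor_when_false
    {X Ψ : Type*} [MeasurableSpace X] [MeasurableSpace Ψ]
    (μ : Measure X) [SigmaFinite μ]
    (Pr : Measure Ψ) [IsProbabilityMeasure Pr]
    (m : Ψ → X → ℝ≥0∞) (hm : Measurable (Function.uncurry m))
    (hprob : ∀ ψ, IsProbabilityMeasure (μ.withDensity (m ψ)))
    (mbar : X → ℝ≥0∞) (hmbar : ∀ x, mbar x = ∫⁻ ψ, m ψ x ∂Pr)
    (ψs : Ψ) :
    (Pr {ψs} = 0 →
      ∀ D : Set X, MeasurableSet D →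
        μ.withDensity (m ψs) D ≤ μ.withDensity (m ψs) {x | m ψs x ≤ mbar x} →
        ∫⁻ ψ in {ψs}ᶜ, μ.withDensity (m ψ) D ∂Pr ≤
          ∫⁻ ψ in {ψs}ᶜ, μ.withDensity (m ψ) {x | m ψs x ≤ mbar x} ∂Pr) ∧
    (∀ D : Set X, MeasurableSet D →
      μ.withDensity (m ψs) D = μ.withDensity (m ψs) {x | m ψs x ≤ mbar x} →
      ∫⁻ ψ in {ψs}ᶜ, μ.withDensity (m ψ) D ∂Pr ≤
        ∫⁻ ψ in {ψs}ᶜ, μ.withDensity (m ψ) {x | m ψs x ≤ mbar x} ∂Pr) := by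
  have hmψ : ∀ ψ, Measurable (m ψ) := fun ψ => hm.comp measurable_prodMk_left
  have hmbar_meas : Measurable mbar := by
    rw [funext hmbar]
    exact hm.lintegral_prod_left'
  have hR : MeasurableSet {x | m ψs x ≤ mbar x} := measurableSet_le (hmψ ψs) hmbar_meas
  have hmix : ∀ D : Set X, MeasurableSet D →
      ∫⁻ ψ, μ.withDensity (m ψ) D ∂Pr = ∫⁻ x in D, mbar x ∂μ := by
    intro D hD
    simp_rw [withDensity_apply _ hD, hmbar]
    exact lintegral_lintegral_swap hm.aemeasurable
  have hmono : ∀ D : Set X, MeasurableSet D →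
      μ.withDensity (m ψs) D ≤ μ.withDensity (m ψs) {x | m ψs x ≤ mbar x} →
      ∫⁻ ψ, μ.withDensity (m ψ) D ∂Pr ≤
        ∫⁻ ψ, μ.withDensity (m ψ) {x | m ψs x ≤ mbar x} ∂Pr := by
    intro D hD h
    have hfin : μ.withDensity (m ψs) D ≠ ∞ := measure_ne_top _ _
    rw [hmix D hD, hmix _ hR]
    rw [withDensity_apply _ hD] at hfin h
    rw [withDensity_apply _ hR] at h
    exact setLIntegral_le_setLIntegral_setOf_le (hmψ ψs) hmbar_meas hD hfin h
  refine ⟨fun h0 D hD h => ?_, fun D hD h => ?_⟩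
  · rw [Measure.restrict_eq_self_of_ae_mem (s := {ψs}ᶜ) (compl_mem_ae_iff.2 h0)]
    exact hmono D hD h
  · by_cases hs : MeasurableSet {ψs}
    · have hsplit : ∀ E : Set X, ∫⁻ ψ, μ.withDensity (m ψ) E ∂Pr =
          μ.withDensity (m ψs) E * Pr {ψs} + ∫⁻ ψ in {ψs}ᶜ, μ.withDensity (m ψ) E ∂Pr := by
        intro E
        rw [← lintegral_add_compl _ hs, ← setLIntegral_const]
        congr 1
        refine setLIntegral_congr_fun hs fun ψ hψ => ?_
        rw [Set.mem_singleton_iff.1 hψ]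
      have hle := hmono D hD h.le
      rw [hsplit D, hsplit {x | m ψs x ≤ mbar x}, h] at hle
      exact (ENNReal.add_le_add_iff_left
        (ENNReal.mul_ne_top (measure_ne_top _ _) (measure_ne_top _ _))).1 hle
    · rw [Measure.restrict_compl_singleton_of_not_measurableSet Pr hs]
      exact hmono D hD h.le
end

section
/- Let ψ* ↦ D(ψ*) assign to each ψ* ∈ Ψ a measurable subset of 𝒳 such that {(ψ*, x) : x ∈ D(ψ*)} is measurable in the product σ-algebra, and suppose M_{ψ*}(D(ψ*)) ≤ M_{ψ*}(R(ψ*)) for every ψ*, where R(ψ*) = {x : m_{ψ*}(x) ≤ m(x)}. Then ∫_Ψ M(D(ψ*)) Π(dψ*) ≤ ∫_Ψ M(R(ψ*)) Π(dψ*). Equivalently, writing C(x) = {ψ : x ∉ D(ψ)} for the associated region of values receiving evidence in favor, the prior probability E_Π(M(ψ* ∉ C(X))) that C fails to cover a value ψ* generated from the prior is maximized, among all regions C whose non-coverage probability of the true value satisfies M(ψ* ∉ C(X) | ψ*) ≤ M(ψ* ∉ Pl(X) | ψ*) for every ψ*, by the plausible region C = Pl. -/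
open MeasureTheory
open scoped ENNReal

/-- Neyman–Pearson comparison: among sets `D` whose `f`-mass is at most that of
`{x | f x ≤ g x}`, the latter has the largest `g`-mass. -/
theorem withDensity_apply_le_of_withDensity_apply_setOf_le
    {X : Type*} [MeasurableSpace X] {μ : Measure X} {f g : X → ℝ≥0∞}
    (hf : Measurable f) (hg : Measurable g) [IsFiniteMeasure (μ.withDensity f)]
    {D : Set X} (hD : MeasurableSet D)
    (hle : μ.withDensity f D ≤ μ.withDensity f {x | f x ≤ g x}) :
    μ.withDensity g D ≤ μ.withDensity g {x | f x ≤ g x} := by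
  set R := {x | f x ≤ g x}
  have hR : MeasurableSet R := measurableSet_le hf hg
  have h_diff_D : μ.withDensity g (D \ R) ≤ μ.withDensity f (D \ R) := by
    rw [withDensity_apply _ (hD.diff hR), withDensity_apply _ (hD.diff hR)]
    exact setLIntegral_mono hf fun x hx => (not_le.mp hx.2).le
  have h_diff_R : μ.withDensity f (R \ D) ≤ μ.withDensity g (R \ D) := by
    rw [withDensity_apply _ (hR.diff hD), withDensity_apply _ (hR.diff hD)]
    exact setLIntegral_mono hg fun x hx => hx.1
  have h_diff : μ.withDensity f (D \ R) ≤ μ.withDensity f (R \ D) := by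
    rw [← measure_inter_add_sdiff D hR, ← measure_inter_add_sdiff R hD, Set.inter_comm R D] at hle
    exact (ENNReal.add_le_add_iff_left (measure_ne_top _ _)).mp hle
  rw [← measure_inter_add_sdiff D hR, ← measure_inter_add_sdiff R hD, Set.inter_comm R D]
  exact add_le_add_right (h_diff_D.trans (h_diff.trans h_diff_R)) _

/-- **Theorem 2(i)** (Evans–Guo): if `D(ψ*)` is a product-measurable family of "no evidence
in favor" rules with `M_{ψ*}(D(ψ*)) ≤ M_{ψ*}(R(ψ*))` for every `ψ*`, where
`R(ψ*) = {x | m_{ψ*}(x) ≤ m(x)}`, then `∫ M(D(ψ*)) Π(dψ*) ≤ ∫ M(R(ψ*)) Π(dψ*)`; that is,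
the plausible region `Pl` maximizes the prior probability of not covering a value generated
from the prior, among all region estimators with pointwise no larger non-coverage
probability of the true value. -/
theorem plausible_region_maximizes_prior_noncoverage
    {X Ψ : Type*} [MeasurableSpace X] [MeasurableSpace Ψ]
    (μ : Measure X) [SigmaFinite μ]
    (Pr : Measure Ψ) [IsProbabilityMeasure Pr]
    (m : Ψ → X → ℝ≥0∞) (hm : Measurable (Function.uncurry m))
    (hprob : ∀ ψ, IsProbabilityMeasure (μ.withDensity (m ψ)))
    (mbar : X → ℝ≥0∞) (hmbar : ∀ x, mbar x = ∫⁻ ψ, m ψ x ∂Pr)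
    (D : Ψ → Set X) (hDmeas : MeasurableSet {p : Ψ × X | p.2 ∈ D p.1})
    (hle : ∀ ψs, μ.withDensity (m ψs) (D ψs) ≤
      μ.withDensity (m ψs) {x | m ψs x ≤ mbar x}) :
    ∫⁻ ψs, μ.withDensity mbar (D ψs) ∂Pr ≤
      ∫⁻ ψs, μ.withDensity mbar {x | m ψs x ≤ mbar x} ∂Pr := by
  have hmbar_meas : Measurable mbar := by
    rw [funext hmbar]
    exact hm.lintegral_prod_left'
  refine lintegral_mono fun ψ => ?_
  have := hprob ψ
  exact withDensity_apply_le_of_withDensity_apply_setOf_le (f := m ψ)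
    (hm.comp measurable_prodMk_left) hmbar_meas (measurable_prodMk_left hDmeas) (hle ψ)
end

section
/- Let ψ* ↦ D(ψ*) assign to each ψ* ∈ Ψ a measurable subset of 𝒳 such that {(ψ*, x) : x ∈ D(ψ*)} is product-measurable, and let R(ψ*) = {x : m_{ψ*}(x) ≤ m(x)}. (i) If Π({ψ}) = 0 for every ψ ∈ Ψ and M_{ψ*}(D(ψ*)) ≤ M_{ψ*}(R(ψ*)) for every ψ*, then ∫_Ψ ∫_{Ψ∖{ψ*}} M_ψ(D(ψ*)) Π(dψ) Π(dψ*) ≤ ∫_Ψ ∫_{Ψ∖{ψ*}} M_ψ(R(ψ*)) Π(dψ) Π(dψ*); that is, the plausible region Pl maximizes the prior probability of not covering a false value. (ii) For an arbitrary prior Π, the same double-integral inequality holds provided M_{ψ*}(D(ψ*)) = M_{ψ*}(R(ψ*)) for every ψ*. -/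
open MeasureTheory
open scoped ENNReal

namespace PlausibleRegion

/-- Neyman–Pearson comparison: among sets whose `f`-mass is at most that of `{x | f x ≤ g x}`,
that set has the largest `g`-mass. -/
lemma withDensity_le_of_withDensity_le_setOf_le {X : Type*} [MeasurableSpace X] {μ : Measure X}
    {f g : X → ℝ≥0∞} (hf : Measurable f) (hg : Measurable g)
    [IsFiniteMeasure (μ.withDensity f)] {D : Set X} (hD : MeasurableSet D)
    (h : μ.withDensity f D ≤ μ.withDensity f {x | f x ≤ g x}) :
    μ.withDensity g D ≤ μ.withDensity g {x | f x ≤ g x} := by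
  set R : Set X := {x | f x ≤ g x} with hRdef
  have hR : MeasurableSet R := measurableSet_le hf hg
  have hDR : μ.withDensity g (D \ R) ≤ μ.withDensity f (D \ R) := by
    rw [withDensity_apply _ (hD.diff hR), withDensity_apply _ (hD.diff hR)]
    exact setLIntegral_mono hf fun x hx => (not_le.mp hx.2).le
  have hRD : μ.withDensity f (R \ D) ≤ μ.withDensity g (R \ D) := by
    rw [withDensity_apply _ (hR.diff hD), withDensity_apply _ (hR.diff hD)]
    exact setLIntegral_mono hg fun x hx => hx.1
  have hmid : μ.withDensity f (D \ R) ≤ μ.withDensity f (R \ D) := by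
    rw [← measure_inter_add_sdiff D hR, ← measure_inter_add_sdiff R hD, Set.inter_comm R D] at h
    exact (ENNReal.add_le_add_iff_left (measure_ne_top _ _)).mp h
  rw [← measure_inter_add_sdiff D hR, ← measure_inter_add_sdiff R hD, Set.inter_comm R D]
  exact add_le_add le_rfl (hDR.trans (hmid.trans hRD))

/-- Removing a non-measurable point does not change a measure. -/
lemma restrict_compl_singleton_of_not_measurableSet {α : Type*} [MeasurableSpace α]
    (μ : Measure α) {a : α} (ha : ¬ MeasurableSet {a}) : μ.restrict {a}ᶜ = μ := by
  refine Measure.ext fun B hB => ?_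
  rw [Measure.restrict_apply hB]
  refine le_antisymm (measure_mono Set.inter_subset_left) ?_
  rw [← measure_toMeasurable (B ∩ {a}ᶜ)]
  refine measure_mono fun x hxB => ?_
  by_contra hx
  have hsub := subset_toMeasurable μ (B ∩ {a}ᶜ)
  have hxa : x = a := by
    by_contra hne
    exact hx (hsub ⟨hxB, hne⟩)
  subst hxa
  refine ha ?_
  have heq : B \ toMeasurable μ (B ∩ {x}ᶜ) = {x} := by
    ext y
    refine ⟨fun hy => ?_, fun hy => ?_⟩
    · by_contra hne
      exact hy.2 (hsub ⟨hy.1, hne⟩)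
    · rw [Set.mem_singleton_iff.mp hy]
      exact ⟨hxB, hx⟩
  exact heq ▸ hB.diff (measurableSet_toMeasurable _ _)

/-- If `F` and `G` agree at `a`, an inequality between their integrals persists when the point `a`
is removed, whether or not `{a}` is measurable. -/
lemma setLIntegral_compl_singleton_le {α : Type*} [MeasurableSpace α] {μ : Measure α}
    [IsFiniteMeasure μ] {F G : α → ℝ≥0∞} {a : α} (hF : Measurable F) (hG : Measurable G)
    (ha : F a = G a) (hGa : G a ≠ ∞) (h : ∫⁻ x, F x ∂μ ≤ ∫⁻ x, G x ∂μ) :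
    ∫⁻ x in {a}ᶜ, F x ∂μ ≤ ∫⁻ x in {a}ᶜ, G x ∂μ := by
  by_cases hm : MeasurableSet {a}
  · rw [← lintegral_add_compl F hm, ← lintegral_add_compl G hm, Measure.restrict_singleton,
      lintegral_smul_measure, lintegral_smul_measure, lintegral_dirac' a hF,
      lintegral_dirac' a hG, ha] at h
    exact (ENNReal.add_le_add_iff_left (ENNReal.mul_ne_top (measure_ne_top _ _) hGa)).mp h
  · rwa [restrict_compl_singleton_of_not_measurableSet μ hm]

/-- The mixture of the measures with densities `m ψ` has the averaged density. -/
lemma lintegral_withDensity_apply {X Ψ : Type*} [MeasurableSpace X] [MeasurableSpace Ψ]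
    {μ : Measure X} [SFinite μ] {ν : Measure Ψ} [SFinite ν] {m : Ψ → X → ℝ≥0∞}
    (hm : Measurable (Function.uncurry m)) {A : Set X} (hA : MeasurableSet A) :
    ∫⁻ ψ, μ.withDensity (m ψ) A ∂ν = μ.withDensity (fun x => ∫⁻ ψ, m ψ x ∂ν) A := by
  simp_rw [withDensity_apply _ hA]
  exact lintegral_lintegral_swap hm.aemeasurable

lemma measurable_withDensity_apply {X Ψ : Type*} [MeasurableSpace X] [MeasurableSpace Ψ]
    {μ : Measure X} [SFinite μ] {m : Ψ → X → ℝ≥0∞}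
    (hm : Measurable (Function.uncurry m)) {A : Set X} (hA : MeasurableSet A) :
    Measurable fun ψ => μ.withDensity (m ψ) A := by
  simp_rw [withDensity_apply _ hA]
  exact hm.lintegral_prod_right'

end PlausibleRegion

/-- **Theorem 2(ii)** (Evans–Guo): the plausible region maximizes the prior probability of
not covering a false value. For a product-measurable family of rules `D(ψ*)` with
`R(ψ*) = {x | m_{ψ*}(x) ≤ m(x)}`: (i) if `Π({ψ}) = 0` for every `ψ` and
`M_{ψ*}(D(ψ*)) ≤ M_{ψ*}(R(ψ*))` for every `ψ*`, then the double integral over false values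
of the non-coverage probability is maximized by `R`; (ii) for an arbitrary prior, the same
holds provided `M_{ψ*}(D(ψ*)) = M_{ψ*}(R(ψ*))` for every `ψ*`. -/
theorem plausible_region_maximizes_prob_not_covering_false_value
    {X Ψ : Type*} [MeasurableSpace X] [MeasurableSpace Ψ]
    (μ : Measure X) [SigmaFinite μ]
    (Pr : Measure Ψ) [IsProbabilityMeasure Pr]
    (m : Ψ → X → ℝ≥0∞) (hm : Measurable (Function.uncurry m))
    (hprob : ∀ ψ, IsProbabilityMeasure (μ.withDensity (m ψ)))
    (mbar : X → ℝ≥0∞) (hmbar : ∀ x, mbar x = ∫⁻ ψ, m ψ x ∂Pr)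
    (D : Ψ → Set X) (hDmeas : MeasurableSet {p : Ψ × X | p.2 ∈ D p.1}) :
    ((∀ ψ : Ψ, Pr {ψ} = 0) →
      (∀ ψs, μ.withDensity (m ψs) (D ψs) ≤
        μ.withDensity (m ψs) {x | m ψs x ≤ mbar x}) →
      ∫⁻ ψs, ∫⁻ ψ in {ψs}ᶜ, μ.withDensity (m ψ) (D ψs) ∂Pr ∂Pr ≤
        ∫⁻ ψs, ∫⁻ ψ in {ψs}ᶜ, μ.withDensity (m ψ) {x | m ψs x ≤ mbar x} ∂Pr ∂Pr) ∧
    ((∀ ψs, μ.withDensity (m ψs) (D ψs) =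
        μ.withDensity (m ψs) {x | m ψs x ≤ mbar x}) →
      ∫⁻ ψs, ∫⁻ ψ in {ψs}ᶜ, μ.withDensity (m ψ) (D ψs) ∂Pr ∂Pr ≤
        ∫⁻ ψs, ∫⁻ ψ in {ψs}ᶜ, μ.withDensity (m ψ) {x | m ψs x ≤ mbar x} ∂Pr ∂Pr) := by
  obtain rfl : mbar = fun x => ∫⁻ ψ, m ψ x ∂Pr := funext hmbar
  have hms : ∀ ψ, Measurable (m ψ) := fun ψ => hm.comp measurable_prodMk_left
  have hmb : Measurable fun x => ∫⁻ ψ, m ψ x ∂Pr := hm.lintegral_prod_left'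
  have hD : ∀ ψs, MeasurableSet (D ψs) := fun ψs => measurable_prodMk_left hDmeas
  have hR : ∀ ψs, MeasurableSet {x | m ψs x ≤ ∫⁻ ψ, m ψ x ∂Pr} :=
    fun ψs => measurableSet_le (hms ψs) hmb
  have key : ∀ ψs, μ.withDensity (m ψs) (D ψs) ≤
        μ.withDensity (m ψs) {x | m ψs x ≤ ∫⁻ ψ, m ψ x ∂Pr} →
      ∫⁻ ψ, μ.withDensity (m ψ) (D ψs) ∂Pr ≤
        ∫⁻ ψ, μ.withDensity (m ψ) {x | m ψs x ≤ ∫⁻ ψ, m ψ x ∂Pr} ∂Pr := by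
    intro ψs h
    rw [PlausibleRegion.lintegral_withDensity_apply hm (hD ψs),
      PlausibleRegion.lintegral_withDensity_apply hm (hR ψs)]
    exact PlausibleRegion.withDensity_le_of_withDensity_le_setOf_le (hms ψs) hmb (hD ψs) h
  refine ⟨fun hnull h => lintegral_mono fun ψs => ?_, fun h => lintegral_mono fun ψs => ?_⟩
  · have hres : Pr.restrict {ψs}ᶜ = Pr :=
      Measure.restrict_eq_self_of_ae_mem (measure_eq_zero_iff_ae_notMem.mp (hnull ψs))
    simpa only [hres] using key ψs (h ψs)
  · exact PlausibleRegion.setLIntegral_compl_singleton_le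
      (PlausibleRegion.measurable_withDensity_apply hm (hD ψs))
      (PlausibleRegion.measurable_withDensity_apply hm (hR ψs))
      (h ψs) (measure_ne_top _ _) (key ψs (h ψs).le)
end

section
/- Fix ψ* ∈ Ψ with Π(Ψ∖{ψ*}) > 0 and let R(ψ*) = {x : m_{ψ*}(x) ≤ m(x)}. Then Π(Ψ∖{ψ*}) · M_{ψ*}(R(ψ*)) ≤ ∫_{Ψ∖{ψ*}} M_ψ(R(ψ*)) Π(dψ). Equivalently, the prior probability of getting evidence in favor of ψ* when ψ* is true, M_{ψ*}(𝒳∖R(ψ*)), is greater than or equal to the Π-average, over false values ψ ≠ ψ*, of the prior probability M_ψ(𝒳∖R(ψ*)) of getting evidence in favor of ψ* when ψ* is false (the average being ∫_{Ψ∖{ψ*}} M_ψ(𝒳∖R(ψ*)) Π(dψ) / Π(Ψ∖{ψ*})). -/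
open MeasureTheory
open scoped ENNReal

/-- If `f c` is at most the mean of `f`, then it is at most the mean of `f` off `c`, in
unnormalized form. The point `c` need not be measurable. -/
theorem measure_compl_singleton_mul_le_setLIntegral {Ψ : Type*} [MeasurableSpace Ψ]
    (P : Measure Ψ) [IsProbabilityMeasure P] (f : Ψ → ℝ≥0∞) (c : Ψ) (hc : f c ≠ ∞)
    (h : f c ≤ ∫⁻ ψ, f ψ ∂P) :
    P {c}ᶜ * f c ≤ ∫⁻ ψ in {c}ᶜ, f ψ ∂P := by
  rw [← Measure.restrict_toMeasurable (measure_ne_top P {c}ᶜ),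
    ← measure_toMeasurable {c}ᶜ]
  set T := toMeasurable P {c}ᶜ
  have hT : MeasurableSet T := measurableSet_toMeasurable _ _
  have hsub : Tᶜ ⊆ {c} := Set.compl_subset_comm.mp (subset_toMeasurable P {c}ᶜ)
  have hcompl : ∫⁻ ψ in Tᶜ, f ψ ∂P = P Tᶜ * f c := by
    rw [setLIntegral_congr_fun hT.compl (g := fun _ => f c)
      (fun ψ hψ => congrArg f (hsub hψ)), setLIntegral_const, mul_comm]
  rw [← lintegral_add_compl f hT, hcompl] at h
  have hone : f c = P T * f c + P Tᶜ * f c := by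
    rw [← add_mul, measure_add_measure_compl hT, measure_univ, one_mul]
  exact (ENNReal.add_le_add_iff_right
    (ENNReal.mul_ne_top (measure_ne_top P Tᶜ) hc)).mp (hone ▸ h)

/-- **Theorem 3(i)** (Evans–Guo): fix `ψ*` with `Π(Ψ∖{ψ*}) > 0` and let
`R(ψ*) = {x | m_{ψ*}(x) ≤ m(x)}`. Then
`Π(Ψ∖{ψ*}) · M_{ψ*}(R(ψ*)) ≤ ∫_{Ψ∖{ψ*}} M_ψ(R(ψ*)) Π(dψ)`; equivalently, the prior
probability of getting evidence in favor of `ψ*` when it is true is at least the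
`Π`-average over false values of the probability of getting evidence in favor of `ψ*`. -/
theorem evidence_in_favor_more_likely_when_true
    {X Ψ : Type*} [MeasurableSpace X] [MeasurableSpace Ψ]
    (μ : Measure X) [SigmaFinite μ]
    (Pr : Measure Ψ) [IsProbabilityMeasure Pr]
    (m : Ψ → X → ℝ≥0∞) (hm : Measurable (Function.uncurry m))
    (hprob : ∀ ψ, IsProbabilityMeasure (μ.withDensity (m ψ)))
    (mbar : X → ℝ≥0∞) (hmbar : ∀ x, mbar x = ∫⁻ ψ, m ψ x ∂Pr)
    (ψs : Ψ) (hpos : 0 < Pr {ψs}ᶜ) :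
    Pr {ψs}ᶜ * μ.withDensity (m ψs) {x | m ψs x ≤ mbar x} ≤
      ∫⁻ ψ in {ψs}ᶜ, μ.withDensity (m ψ) {x | m ψs x ≤ mbar x} ∂Pr := by
  have hmbar_meas : Measurable mbar := by
    rw [funext hmbar]
    exact hm.lintegral_prod_left'
  have hψ : ∀ ψ, Measurable (m ψ) := fun ψ => hm.of_uncurry_left
  have hR : MeasurableSet {x | m ψs x ≤ mbar x} := measurableSet_le (hψ ψs) hmbar_meas
  have hfin : ∀ᵐ x ∂μ, m ψs x ≠ ∞ := by
    have hne : ∫⁻ x, m ψs x ∂μ ≠ ∞ := by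
      rw [← setLIntegral_univ, ← withDensity_apply _ MeasurableSet.univ]
      exact measure_ne_top _ _
    exact (ae_lt_top (hψ ψs) hne).mono fun _ hx => hx.ne
  simp_rw [withDensity_apply _ hR]
  rw [lintegral_lintegral_swap hm.aemeasurable, ← lintegral_const_mul _ (hψ ψs)]
  refine lintegral_mono_ae ?_
  filter_upwards [ae_restrict_mem hR, ae_restrict_of_ae hfin] with x hx hxfin
  exact measure_compl_singleton_mul_le_setLIntegral Pr (fun ψ => m ψ x) ψs hxfin
    (hmbar x ▸ hx)
end

section
/- Fix ψ* ∈ Ψ and let A(ψ*) = {x ∈ 𝒳 : m_{ψ*}(x) ≥ m(x)} be the set of data not giving evidence against ψ* under the principle of evidence. Then for every measurable set E ⊆ 𝒳 satisfying M_{ψ*}(E) ≥ M_{ψ*}(A(ψ*)), one has M(E) ≥ M(A(ψ*)). That is, among all rules for declaring 'no evidence against ψ*' whose conditional prior predictive probability under ψ* is at least that of the principle of evidence, the principle-of-evidence region A(ψ*) minimizes the prior predictive probability M(E). -/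
open MeasureTheory
open scoped ENNReal

/-- A Neyman–Pearson type inequality: among the measurable sets whose `g`-mass is at least that of
`{x | f x ≤ g x}`, this region has the least `f`-mass. -/
theorem withDensity_setOf_le_le_of_withDensity_setOf_le_le
    {X : Type*} [MeasurableSpace X] {μ : Measure X} {f g : X → ℝ≥0∞}
    (hf : Measurable f) (hg : Measurable g) [IsFiniteMeasure (μ.withDensity g)]
    {E : Set X} (hE : MeasurableSet E)
    (hge : μ.withDensity g {x | f x ≤ g x} ≤ μ.withDensity g E) :
    μ.withDensity f {x | f x ≤ g x} ≤ μ.withDensity f E := by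
  have hA : MeasurableSet {x | f x ≤ g x} := measurableSet_le hf hg
  set A := {x | f x ≤ g x}
  have hAE : μ.withDensity f (A \ E) ≤ μ.withDensity g (A \ E) := by
    rw [withDensity_apply _ (hA.diff hE), withDensity_apply _ (hA.diff hE)]
    exact setLIntegral_mono hg fun x hx => hx.1
  have hEA : μ.withDensity g (E \ A) ≤ μ.withDensity f (E \ A) := by
    rw [withDensity_apply _ (hE.diff hA), withDensity_apply _ (hE.diff hA)]
    exact setLIntegral_mono hf fun x hx => (not_le.mp hx.2).le
  have hdiff : μ.withDensity g (A \ E) ≤ μ.withDensity g (E \ A) := by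
    rw [← measure_inter_add_sdiff A hE, ← measure_inter_add_sdiff E hA, Set.inter_comm E A] at hge
    exact (ENNReal.add_le_add_iff_left (measure_ne_top _ _)).mp hge
  rw [← measure_inter_add_sdiff A hE, ← measure_inter_add_sdiff E hA, Set.inter_comm E A]
  exact add_le_add_right (hAE.trans (hdiff.trans hEA)) _

/-- **Theorem 4(i)** (Evans–Guo): among all rules `E` for declaring "no evidence against
`ψ*`" whose conditional prior predictive probability under `ψ*` is at least that of the
principle-of-evidence region `A(ψ*) = {x | m_{ψ*}(x) ≥ m(x)}`, the region `A(ψ*)` minimizes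
the prior predictive probability `M(E)`. -/
theorem principle_of_evidence_minimizes_prior_prob_no_evidence_against
    {X Ψ : Type*} [MeasurableSpace X] [MeasurableSpace Ψ]
    (μ : Measure X) [SigmaFinite μ]
    (Pr : Measure Ψ) [IsProbabilityMeasure Pr]
    (m : Ψ → X → ℝ≥0∞) (hm : Measurable (Function.uncurry m))
    (hprob : ∀ ψ, IsProbabilityMeasure (μ.withDensity (m ψ)))
    (mbar : X → ℝ≥0∞) (hmbar : ∀ x, mbar x = ∫⁻ ψ, m ψ x ∂Pr)
    (ψs : Ψ) (E : Set X) (hE : MeasurableSet E)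
    (hge : μ.withDensity (m ψs) {x | mbar x ≤ m ψs x} ≤ μ.withDensity (m ψs) E) :
    μ.withDensity mbar {x | mbar x ≤ m ψs x} ≤ μ.withDensity mbar E := by
  have hmbar_meas : Measurable mbar := by
    rw [funext hmbar]
    exact hm.lintegral_prod_left'
  have := hprob ψs
  have hms : Measurable (m ψs) := hm.comp measurable_prodMk_left
  exact withDensity_setOf_le_le_of_withDensity_setOf_le_le hmbar_meas
    hms hE hge
end

section
/- Fix ψ* ∈ Ψ and let A(ψ*) = {x : m_{ψ*}(x) ≥ m(x)}. (i) If Π({ψ*}) = 0, then for every measurable set E ⊆ 𝒳 with M_{ψ*}(E) ≥ M_{ψ*}(A(ψ*)), one has ∫_{Ψ∖{ψ*}} M_ψ(E) Π(dψ) ≥ ∫_{Ψ∖{ψ*}} M_ψ(A(ψ*)) Π(dψ); that is, A(ψ*) minimizes the prior probability of not obtaining evidence against ψ* when ψ* is false. (ii) For an arbitrary prior Π, the same inequality holds for every measurable E satisfying M_{ψ*}(E) = M_{ψ*}(A(ψ*)). -/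
open MeasureTheory
open scoped ENNReal

/-- Neyman–Pearson comparison: if `{g ≤ f}` has no more `f`-mass than `E`, then it has no more
`g`-mass than `E`. -/
theorem withDensity_setOf_le_le_of_withDensity_le {X : Type*} [MeasurableSpace X]
    {μ : Measure X} {f g : X → ℝ≥0∞} (hf : Measurable f) (hg : Measurable g)
    [IsFiniteMeasure (μ.withDensity f)] {E : Set X} (hE : MeasurableSet E)
    (h : μ.withDensity f {x | g x ≤ f x} ≤ μ.withDensity f E) :
    μ.withDensity g {x | g x ≤ f x} ≤ μ.withDensity g E := by
  set A := {x | g x ≤ f x} with hA_def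
  have hA : MeasurableSet A := measurableSet_le hg hf
  have hdiff : μ.withDensity f (A \ E) ≤ μ.withDensity f (E \ A) := by
    rw [← measure_inter_add_sdiff A hE, ← measure_inter_add_sdiff E hA, Set.inter_comm E A] at h
    exact (ENNReal.add_le_add_iff_left (measure_ne_top _ _)).1 h
  have hAE : μ.withDensity g (A \ E) ≤ μ.withDensity f (A \ E) := by
    rw [withDensity_apply _ (hA.diff hE), withDensity_apply _ (hA.diff hE)]
    exact setLIntegral_mono hf fun x hx => hx.1
  have hEA : μ.withDensity f (E \ A) ≤ μ.withDensity g (E \ A) := by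
    rw [withDensity_apply _ (hE.diff hA), withDensity_apply _ (hE.diff hA)]
    exact setLIntegral_mono hg fun x hx => (not_le.1 hx.2).le
  rw [← measure_inter_add_sdiff A hE, ← measure_inter_add_sdiff E hA, Set.inter_comm E A]
  refine add_le_add_right ?_ _
  exact hAE.trans (hdiff.trans hEA)

/-- Mixing the measures with densities `m ψ` gives the measure whose density is the mixture. -/
theorem lintegral_withDensity_apply_eq {X Ψ : Type*} [MeasurableSpace X] [MeasurableSpace Ψ]
    (μ : Measure X) [SFinite μ] (ν : Measure Ψ) [SFinite ν] {m : Ψ → X → ℝ≥0∞}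
    (hm : Measurable (Function.uncurry m)) {E : Set X} (hE : MeasurableSet E) :
    ∫⁻ ψ, μ.withDensity (m ψ) E ∂ν = μ.withDensity (fun x => ∫⁻ ψ, m ψ x ∂ν) E := by
  simp_rw [withDensity_apply _ hE]
  exact lintegral_lintegral_swap hm.aemeasurable

/-- **Theorem 4(ii)** (Evans–Guo): the principle-of-evidence region
`A(ψ*) = {x | m_{ψ*}(x) ≥ m(x)}` minimizes the prior probability of not obtaining evidence
against `ψ*` when it is false: (i) when `Π({ψ*}) = 0`, among all rules `E` with
`M_{ψ*}(E) ≥ M_{ψ*}(A(ψ*))`; (ii) for arbitrary priors, among all rules `E` with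
`M_{ψ*}(E) = M_{ψ*}(A(ψ*))`. -/
theorem principle_of_evidence_minimizes_prob_no_evidence_against_when_false
    {X Ψ : Type*} [MeasurableSpace X] [MeasurableSpace Ψ]
    (μ : Measure X) [SigmaFinite μ]
    (Pr : Measure Ψ) [IsProbabilityMeasure Pr]
    (m : Ψ → X → ℝ≥0∞) (hm : Measurable (Function.uncurry m))
    (hprob : ∀ ψ, IsProbabilityMeasure (μ.withDensity (m ψ)))
    (mbar : X → ℝ≥0∞) (hmbar : ∀ x, mbar x = ∫⁻ ψ, m ψ x ∂Pr)
    (ψs : Ψ) :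
    (Pr {ψs} = 0 →
      ∀ E : Set X, MeasurableSet E →
        μ.withDensity (m ψs) {x | mbar x ≤ m ψs x} ≤ μ.withDensity (m ψs) E →
        ∫⁻ ψ in {ψs}ᶜ, μ.withDensity (m ψ) {x | mbar x ≤ m ψs x} ∂Pr ≤
          ∫⁻ ψ in {ψs}ᶜ, μ.withDensity (m ψ) E ∂Pr) ∧
    (∀ E : Set X, MeasurableSet E →
      μ.withDensity (m ψs) E = μ.withDensity (m ψs) {x | mbar x ≤ m ψs x} →
      ∫⁻ ψ in {ψs}ᶜ, μ.withDensity (m ψ) {x | mbar x ≤ m ψs x} ∂Pr ≤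
        ∫⁻ ψ in {ψs}ᶜ, μ.withDensity (m ψ) E ∂Pr) := by
  have hms : Measurable (m ψs) := hm.of_uncurry_left
  have hmbar_meas : Measurable mbar := by
    rw [funext hmbar]
    exact hm.lintegral_prod_left'
  have hA : MeasurableSet {x | mbar x ≤ m ψs x} := measurableSet_le hmbar_meas hms
  have hmix : ∀ E : Set X, MeasurableSet E →
      ∫⁻ ψ, μ.withDensity (m ψ) E ∂Pr = μ.withDensity mbar E := fun E hE => by
    rw [lintegral_withDensity_apply_eq μ Pr hm hE, funext hmbar]
  have := hprob ψs
  have key : ∀ E : Set X, MeasurableSet E →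
      μ.withDensity (m ψs) {x | mbar x ≤ m ψs x} ≤ μ.withDensity (m ψs) E →
      ∫⁻ ψ, μ.withDensity (m ψ) {x | mbar x ≤ m ψs x} ∂Pr ≤
        ∫⁻ ψ, μ.withDensity (m ψ) E ∂Pr := fun E hE h => by
    rw [hmix _ hA, hmix _ hE]
    exact withDensity_setOf_le_le_of_withDensity_le hms hmbar_meas hE h
  refine ⟨fun h0 E hE h => ?_, fun E hE h => ?_⟩
  · rw [Measure.restrict_eq_self_of_ae_mem (s := {ψs}ᶜ) (compl_mem_ae_iff.2 h0)]
    exact key E hE h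
  · by_cases hψs : MeasurableSet {ψs}
    · have h' := key E hE h.ge
      rw [← lintegral_add_compl _ hψs, ← lintegral_add_compl (fun ψ => μ.withDensity (m ψ) E) hψs]
        at h'
      have hsingle : ∀ F : Set X, ∫⁻ ψ in {ψs}, μ.withDensity (m ψ) F ∂Pr =
          μ.withDensity (m ψs) F * Pr {ψs} := fun F => by
        rw [setLIntegral_congr_fun hψs
          (g := fun _ => μ.withDensity (m ψs) F) (by rintro _ rfl; rfl), setLIntegral_const]
      rw [hsingle, hsingle, h] at h'
      exact (ENNReal.add_le_add_iff_left
        (ENNReal.mul_ne_top (measure_ne_top _ _) (measure_ne_top _ _))).1 h'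
    · -- The measurable hull of the complement of a nonmeasurable singleton is the whole space.
      have hull : toMeasurable Pr {ψs}ᶜ = Set.univ := by
        have hT := measurableSet_toMeasurable Pr {ψs}ᶜ
        have hsub := subset_toMeasurable Pr {ψs}ᶜ
        rcases Set.subset_singleton_iff_eq.1 (Set.compl_subset_comm.1 hsub) with h0 | h0
        · exact Set.compl_empty_iff.1 h0
        · exact absurd (h0 ▸ hT.compl) hψs
      rw [← Measure.restrict_toMeasurable (measure_ne_top Pr _), hull, Measure.restrict_univ]
      exact key E hE h.ge
end

section
/- Let ψ* ↦ E(ψ*) assign to each ψ* ∈ Ψ a measurable subset of 𝒳 such that {(ψ*, x) : x ∈ E(ψ*)} is product-measurable, and suppose M_{ψ*}(E(ψ*)) ≥ M_{ψ*}(A(ψ*)) for every ψ*, where A(ψ*) = {x : m_{ψ*}(x) ≥ m(x)}. Then ∫_Ψ M(E(ψ*)) Π(dψ*) ≥ ∫_Ψ M(A(ψ*)) Π(dψ*). Equivalently, writing C(x) = {ψ : x ∈ E(ψ)} for the associated region, the prior probability E_Π(M(ψ* ∈ C(X))) that C covers a value ψ* generated from the prior is minimized, among all regions C whose coverage probability of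 the true value satisfies M(ψ* ∈ C(X) | ψ*) ≥ M(ψ* ∈ Pl(X) | ψ*) for every ψ*, by the plausible region C = Pl. -/
open MeasureTheory
open scoped ENNReal

/-- **Theorem 5(i)** (Evans–Guo): if `E(ψ*)` is a product-measurable family of "no evidence
against" rules with `M_{ψ*}(E(ψ*)) ≥ M_{ψ*}(A(ψ*))` for every `ψ*`, where
`A(ψ*) = {x | m_{ψ*}(x) ≥ m(x)}`, then `∫ M(A(ψ*)) Π(dψ*) ≤ ∫ M(E(ψ*)) Π(dψ*)`; that is,
the plausible region minimizes the prior probability of covering a value generated from the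
prior, among all region estimators with pointwise no smaller coverage probability of the
true value. -/
theorem plausible_region_minimizes_prior_coverage
    {X Ψ : Type*} [MeasurableSpace X] [MeasurableSpace Ψ]
    (μ : Measure X) [SigmaFinite μ]
    (Pr : Measure Ψ) [IsProbabilityMeasure Pr]
    (m : Ψ → X → ℝ≥0∞) (hm : Measurable (Function.uncurry m))
    (hprob : ∀ ψ, IsProbabilityMeasure (μ.withDensity (m ψ)))
    (mbar : X → ℝ≥0∞) (hmbar : ∀ x, mbar x = ∫⁻ ψ, m ψ x ∂Pr)
    (E : Ψ → Set X) (hEmeas : MeasurableSet {p : Ψ × X | p.2 ∈ E p.1})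
    (hge : ∀ ψs, μ.withDensity (m ψs) {x | mbar x ≤ m ψs x} ≤
      μ.withDensity (m ψs) (E ψs)) :
    ∫⁻ ψs, μ.withDensity mbar {x | mbar x ≤ m ψs x} ∂Pr ≤
      ∫⁻ ψs, μ.withDensity mbar (E ψs) ∂Pr := by
  have hmbar_meas : Measurable mbar := by
    rw [funext hmbar]
    exact hm.lintegral_prod_left'
  refine lintegral_mono fun ψ => ?_
  have := hprob ψ
  exact withDensity_setOf_le_le_of_withDensity_le (f := m ψ) (hm.comp measurable_prodMk_left) hmbar_meas
    (measurable_prodMk_left hEmeas) (hge ψ)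
end

section
/- For every ψ* ∈ Ψ, the chain of inequalities ν({ψ*}) ≤ ν({ψ ∈ Ψ : r(ψ) ≤ r(ψ*)}) ≤ r(ψ*) holds. In the relative belief framework this says: the posterior probability of {ψ*} is at most the strength of the evidence (the posterior probability that the true value has relative belief ratio no greater than that of ψ*), which in turn is at most the relative belief ratio of ψ*. -/
open MeasureTheory
open scoped ENNReal

/-- (Evans–Guo, Section 2.1): for prior `λ`, posterior `ν` with relative belief ratio
(density) `r`, the chain `ν({ψ*}) ≤ ν({ψ : r(ψ) ≤ r(ψ*)}) ≤ r(ψ*)` holds: the posterior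
probability of `{ψ*}` is at most the strength of the evidence, which is at most the
relative belief ratio of `ψ*`. -/
theorem posterior_le_strength_le_relative_belief
    {Ψ : Type*} [MeasurableSpace Ψ] [MeasurableSingletonClass Ψ]
    (lam nu : Measure Ψ) [IsProbabilityMeasure lam] [IsProbabilityMeasure nu]
    (r : Ψ → ℝ≥0∞) (hr : Measurable r)
    (hnu : ∀ B : Set Ψ, MeasurableSet B → nu B = ∫⁻ ψ in B, r ψ ∂lam)
    (ψs : Ψ) :
    nu {ψs} ≤ nu {ψ | r ψ ≤ r ψs} ∧ nu {ψ | r ψ ≤ r ψs} ≤ r ψs := by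
  refine ⟨measure_mono (Set.singleton_subset_iff.2 (le_refl (r ψs))), ?_⟩
  have hB : MeasurableSet {ψ | r ψ ≤ r ψs} := measurableSet_le hr measurable_const
  calc nu {ψ | r ψ ≤ r ψs}
      = ∫⁻ ψ in {ψ | r ψ ≤ r ψs}, r ψ ∂lam := hnu _ hB
    _ ≤ ∫⁻ _ in {ψ | r ψ ≤ r ψs}, r ψs ∂lam := setLIntegral_mono measurable_const fun _ h => h
    _ = r ψs * lam {ψ | r ψ ≤ r ψs} := setLIntegral_const _ _
    _ ≤ r ψs := mul_le_of_le_one_right' prob_le_one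
end

section
/- (Jeffreys–Lindley phenomenon.) Fix n ≥ 1, σ₀ > 0, μ₀ ∈ ℝ, x̄ ∈ ℝ and μ ∈ ℝ. Then RB(μ | x̄), regarded as a function of the prior standard deviation τ₀ > 0, tends to +∞ as τ₀ → ∞. That is, for every value μ (in particular any hypothesized value μ*), the relative belief ratio becomes arbitrarily large as the prior becomes arbitrarily diffuse, regardless of the data. -/
open scoped Real

/-- The standard normal cumulative distribution function. -/
noncomputable def Phi (t : ℝ) : ℝ :=
  ∫ u in Set.Iic t, (Real.sqrt (2 * Real.pi))⁻¹ * Real.exp (-u ^ 2 / 2)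

/-- The relative belief ratio of `μ` in the location normal model with known variance
`σ0²`, sample size `n`, sample mean `xbar` and `N(μ0, τ0²)` prior. -/
noncomputable def RB (n : ℕ) (σ0 τ0 μ0 xbar μ : ℝ) : ℝ :=
  Real.sqrt (1 + n * τ0 ^ 2 / σ0 ^ 2) *
    Real.exp (-(1 / 2) * (1 + σ0 ^ 2 / (n * τ0 ^ 2)) *
        (Real.sqrt n * (xbar - μ) / σ0 + σ0 * (μ0 - μ) / (Real.sqrt n * τ0 ^ 2)) ^ 2 +
      (μ - μ0) ^ 2 / (2 * τ0 ^ 2))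

open Filter Topology

/-- **Jeffreys–Lindley phenomenon** (Evans–Guo, Example 1): for any fixed data and any
value `μ`, the relative belief ratio `RB(μ | x̄)` tends to `+∞` as the prior standard
deviation `τ0 → ∞`, regardless of the data. -/
theorem jeffreys_lindley_RB_tendsto_atTop
    (n : ℕ) (hn : 1 ≤ n) (σ0 μ0 xbar μ : ℝ) (hσ0 : 0 < σ0) :
    Filter.Tendsto (fun τ0 : ℝ => RB n σ0 τ0 μ0 xbar μ) Filter.atTop Filter.atTop := by
  have hn' : (0 : ℝ) < n := by exact_mod_cast hn
  have hsq : Tendsto (fun τ : ℝ => τ ^ 2) atTop atTop := tendsto_pow_atTop two_ne_zero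
  have hdiv {c : ℝ} (hc : 0 < c) (a : ℝ) :
      Tendsto (fun τ : ℝ => a / (c * τ ^ 2)) atTop (𝓝 0) :=
    (hsq.const_mul_atTop hc).const_div_atTop a
  have hsqrt : Tendsto (fun τ : ℝ => √(1 + n * τ ^ 2 / σ0 ^ 2)) atTop atTop :=
    Real.tendsto_sqrt_atTop.comp <| tendsto_atTop_add_const_left _ _ <|
      (hsq.const_mul_atTop hn').atTop_div_const (by positivity)
  have hexp := (((((hdiv hn' (σ0 ^ 2)).const_add 1).const_mul (-(1 / 2))).mul
    (((hdiv (Real.sqrt_pos.2 hn') (σ0 * (μ0 - μ))).const_add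
      (√n * (xbar - μ) / σ0)).pow 2)).add (hdiv two_pos ((μ - μ0) ^ 2))).rexp
  exact hsqrt.atTop_mul_pos (Real.exp_pos _) hexp
end

section
/- (Bias against vanishes with sample size or prior diffuseness.) For fixed σ₀, τ₀ > 0 and μ₀, μ* ∈ ℝ, define for each n ≥ 1 the quantities a(n) = σ₀(μ*−μ₀)/(√n τ₀²) and b(n) = { (1 + σ₀²/(nτ₀²)) [ log(1 + nτ₀²/σ₀²) + (μ*−μ₀)²/τ₀² ] }^{1/2}. Then the bias against 1 − Φ(a(n) + b(n)) + Φ(a(n) − b(n)) tends to 0 as n → ∞. Likewise, for fixed n, σ₀, μ₀, μ*, the same expression (with a and b regarded as functions of τ₀) tends to 0 as τ₀ → ∞. -/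
open scoped Real

/-- `a` in the bias formulas of Example 1 (Evans–Guo). -/
noncomputable def aval (n σ0 τ0 μ0 μs : ℝ) : ℝ := σ0 * (μs - μ0) / (Real.sqrt n * τ0 ^ 2)

/-- `b` in the bias formulas of Example 1 (Evans–Guo). -/
noncomputable def bval (n σ0 τ0 μ0 μs : ℝ) : ℝ :=
  Real.sqrt ((1 + σ0 ^ 2 / (n * τ0 ^ 2)) *
    (Real.log (1 + n * τ0 ^ 2 / σ0 ^ 2) + (μs - μ0) ^ 2 / τ0 ^ 2))

/-- The bias against `H₀ = {μ*}`, `1 − Φ(a + b) + Φ(a − b)`, in Example 1 (Evans–Guo). -/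
noncomputable def biasAgainst (n σ0 τ0 μ0 μs : ℝ) : ℝ :=
  1 - Phi (aval n σ0 τ0 μ0 μs + bval n σ0 τ0 μ0 μs) +
    Phi (aval n σ0 τ0 μ0 μs - bval n σ0 τ0 μ0 μs)

theorem Phi_eq_cdf (t : ℝ) :
    Phi t = ProbabilityTheory.cdf (ProbabilityTheory.gaussianReal 0 1) t := by
  rw [ProbabilityTheory.cdf_eq_real, MeasureTheory.measureReal_def,
    ProbabilityTheory.gaussianReal_apply_eq_integral 0 one_ne_zero,
    ENNReal.toReal_ofReal (MeasureTheory.integral_nonneg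
      fun _ => ProbabilityTheory.gaussianPDFReal_nonneg _ _ _)]
  simp [Phi, ProbabilityTheory.gaussianPDFReal]

theorem tendsto_Phi_atTop : Filter.Tendsto Phi Filter.atTop (nhds 1) := by
  rw [funext Phi_eq_cdf]
  exact ProbabilityTheory.tendsto_cdf_atTop _

theorem tendsto_Phi_atBot : Filter.Tendsto Phi Filter.atBot (nhds 0) := by
  rw [funext Phi_eq_cdf]
  exact ProbabilityTheory.tendsto_cdf_atBot _

theorem sqrt_log_le_bval {n : ℝ} (hn : 0 ≤ n) (σ0 τ0 μ0 μs : ℝ) :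
    √(Real.log (1 + n * τ0 ^ 2 / σ0 ^ 2)) ≤ bval n σ0 τ0 μ0 μs := by
  apply Real.sqrt_le_sqrt
  have h1 : 0 ≤ σ0 ^ 2 / (n * τ0 ^ 2) := by positivity
  have h2 : 0 ≤ n * τ0 ^ 2 / σ0 ^ 2 := by positivity
  have h3 : 0 ≤ (μs - μ0) ^ 2 / τ0 ^ 2 := by positivity
  have h4 := Real.log_nonneg (le_add_of_nonneg_right h2)
  nlinarith [mul_nonneg h1 (add_nonneg h4 h3)]

/-- The bias against vanishes along any filter on which both `n τ0²` and `√n τ0²`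
tend to infinity. -/
theorem tendsto_biasAgainst {α : Type*} {l : Filter α} {n τ0 : α → ℝ} {σ0 : ℝ} (hσ0 : 0 < σ0)
    (μ0 μs : ℝ) (hn : ∀ x, 0 ≤ n x)
    (h : Filter.Tendsto (fun x => n x * τ0 x ^ 2) l Filter.atTop)
    (h' : Filter.Tendsto (fun x => √(n x) * τ0 x ^ 2) l Filter.atTop) :
    Filter.Tendsto (fun x => biasAgainst (n x) σ0 (τ0 x) μ0 μs) l (nhds 0) := by
  have ha : Filter.Tendsto (fun x => aval (n x) σ0 (τ0 x) μ0 μs) l (nhds 0) :=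
    h'.const_div_atTop _
  have hb : Filter.Tendsto (fun x => bval (n x) σ0 (τ0 x) μ0 μs) l Filter.atTop :=
    Filter.tendsto_atTop_mono (fun x => sqrt_log_le_bval (hn x) σ0 (τ0 x) μ0 μs) <|
      Real.tendsto_sqrt_atTop.comp <| Real.tendsto_log_atTop.comp <|
        Filter.tendsto_atTop_add_const_left l 1 (h.atTop_div_const (pow_pos hσ0 2))
  have hadd := tendsto_Phi_atTop.comp (ha.add_atTop hb)
  have hsub := tendsto_Phi_atBot.comp (ha.add_atBot (Filter.tendsto_neg_atTop_atBot.comp hb))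
  simpa [biasAgainst, Function.comp_def, ← sub_eq_add_neg] using
    (hadd.const_sub 1).add hsub

/-- **Bias against vanishes with sample size or prior diffuseness** (Evans–Guo, Example 1):
the bias against `1 − Φ(a + b) + Φ(a − b)` tends to `0` as `n → ∞` (for fixed `τ0 > 0`)
and tends to `0` as `τ0 → ∞` (for fixed `n ≥ 1`). -/
theorem bias_against_tendsto_zero
    (σ0 μ0 μs : ℝ) (hσ0 : 0 < σ0) :
    (∀ τ0 : ℝ, 0 < τ0 →
      Filter.Tendsto (fun n : ℕ => biasAgainst n σ0 τ0 μ0 μs) Filter.atTop (nhds 0)) ∧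
    (∀ n : ℕ, 1 ≤ n →
      Filter.Tendsto (fun τ0 : ℝ => biasAgainst n σ0 τ0 μ0 μs) Filter.atTop (nhds 0)) := by
  refine ⟨fun τ0 hτ0 => ?_, fun n hn => ?_⟩
  · have hτ : 0 < τ0 ^ 2 := by positivity
    have hcast := tendsto_natCast_atTop_atTop (R := ℝ)
    exact tendsto_biasAgainst hσ0 μ0 μs (fun n : ℕ => n.cast_nonneg)
      (hcast.atTop_mul_const hτ)
      ((Real.tendsto_sqrt_atTop.comp hcast).atTop_mul_const hτ)
  · have hn0 : (0 : ℝ) < n := by exact_mod_cast hn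
    have hsq : Filter.Tendsto (fun τ : ℝ => τ ^ 2) Filter.atTop Filter.atTop :=
      Filter.tendsto_pow_atTop two_ne_zero
    exact tendsto_biasAgainst hσ0 μ0 μs (fun _ => hn0.le)
      (hsq.const_mul_atTop hn0) (hsq.const_mul_atTop (Real.sqrt_pos.2 hn0))
end

section
/- (Limits of the bias in favor.) With a, b, c as defined (a = σ₀(μ*−μ₀)/(√n τ₀²), b = { (1 + σ₀²/(nτ₀²)) [ log(1 + nτ₀²/σ₀²) + (μ*−μ₀)²/τ₀² ] }^{1/2}, c = √n(μ*−μ)/σ₀ + a): (i) for fixed n ≥ 1, σ₀ > 0 and μ₀, μ*, μ ∈ ℝ, the bias in favor Φ(c + b) − Φ(c − b), regarded as a function of τ₀ > 0, tends to 1 as τ₀ → ∞ (so an arbitrarily diffuse prior produces bias in favor of μ* approaching certainty); (ii) for fixed σ₀, τ₀ > 0 and μ₀, μ*, μ ∈ ℝ with μ ≠ μ*, the same expression, regarded as a function of n, tends to 0 as n → ∞. -/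
open scoped Real

/-- `c` in the bias-in-favor formula of Example 1 (Evans–Guo). -/
noncomputable def cval (n σ0 τ0 μ0 μs μ : ℝ) : ℝ :=
  Real.sqrt n * (μs - μ) / σ0 + aval n σ0 τ0 μ0 μs

/-- The bias in favor of `H₀ = {μ*}` at the value `μ`, `Φ(c + b) − Φ(c − b)`,
in Example 1 (Evans–Guo). -/
noncomputable def biasFavor (n σ0 τ0 μ0 μs μ : ℝ) : ℝ :=
  Phi (cval n σ0 τ0 μ0 μs μ + bval n σ0 τ0 μ0 μs) -
    Phi (cval n σ0 τ0 μ0 μs μ - bval n σ0 τ0 μ0 μs)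

open Filter Topology MeasureTheory ProbabilityTheory

theorem Phi_eq_cdf_s17 (t : ℝ) : Phi t = cdf (gaussianReal 0 1) t := by
  rw [cdf_eq_real, Measure.real, gaussianReal_apply_eq_integral 0 one_ne_zero,
    ENNReal.toReal_ofReal
      (integral_nonneg fun x => gaussianPDFReal_nonneg 0 1 x)]
  simp [Phi, gaussianPDFReal]

theorem tendsto_Phi_atTop_s17 : Tendsto Phi atTop (𝓝 1) := by
  rw [show Phi = cdf (gaussianReal 0 1) from funext Phi_eq_cdf_s17]
  exact tendsto_cdf_atTop _

theorem tendsto_Phi_atBot_s17 : Tendsto Phi atBot (𝓝 0) := by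
  rw [show Phi = cdf (gaussianReal 0 1) from funext Phi_eq_cdf_s17]
  exact tendsto_cdf_atBot _

/-- The logarithm of an affine function with positive slope is sublinear. -/
theorem tendsto_log_one_add_mul_div {k : ℝ} (hk : 0 < k) :
    Tendsto (fun x : ℝ => Real.log (1 + k * x) / x) atTop (𝓝 0) := by
  have haff : Tendsto (fun x : ℝ => 1 + k * x) atTop atTop :=
    tendsto_atTop_add_const_left _ _ (tendsto_id.const_mul_atTop hk)
  have hlog := Real.isLittleO_log_id_atTop.tendsto_div_nhds_zero.comp haff
  have hratio : Tendsto (fun x : ℝ => x⁻¹ + k) atTop (𝓝 (0 + k)) :=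
    tendsto_inv_atTop_zero.add_const k
  have h := hlog.mul hratio
  rw [zero_mul] at h
  refine h.congr' ?_
  filter_upwards [eventually_gt_atTop 0] with x hx
  have : 1 + k * x ≠ 0 := by positivity
  simp only [Function.comp_apply, id]
  field_simp

theorem tendsto_aval_prior (n σ0 μ0 μs : ℝ) (hn : 0 < n) :
    Tendsto (fun τ0 => aval n σ0 τ0 μ0 μs) atTop (𝓝 0) :=
  ((tendsto_pow_atTop two_ne_zero).const_mul_atTop (Real.sqrt_pos.2 hn)).const_div_atTop _

theorem tendsto_bval_prior (n σ0 μ0 μs : ℝ) (hn : 0 < n) (hσ0 : 0 < σ0) :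
    Tendsto (fun τ0 => bval n σ0 τ0 μ0 μs) atTop atTop := by
  have hsq : Tendsto (fun τ : ℝ => τ ^ 2) atTop atTop := tendsto_pow_atTop two_ne_zero
  have hnsq := hsq.const_mul_atTop hn
  have hfac : Tendsto (fun τ : ℝ => 1 + σ0 ^ 2 / (n * τ ^ 2)) atTop (𝓝 (1 + 0)) :=
    (hnsq.const_div_atTop _).const_add 1
  have hlog : Tendsto (fun τ : ℝ => Real.log (1 + n * τ ^ 2 / σ0 ^ 2)) atTop atTop :=
    Real.tendsto_log_atTop.comp
      (tendsto_atTop_add_const_left _ _ (hnsq.atTop_div_const (by positivity)))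
  exact Real.tendsto_sqrt_atTop.comp
    (hfac.pos_mul_atTop (by norm_num) (hlog.atTop_add (hsq.const_div_atTop ((μs - μ0) ^ 2))))

theorem tendsto_aval_size (σ0 τ0 μ0 μs : ℝ) (hτ0 : 0 < τ0) :
    Tendsto (fun x => aval x σ0 τ0 μ0 μs) atTop (𝓝 0) :=
  (Real.tendsto_sqrt_atTop.atTop_mul_const (by positivity)).const_div_atTop _

theorem tendsto_bval_div_sqrt_size (σ0 τ0 μ0 μs : ℝ) (hσ0 : 0 < σ0) (hτ0 : 0 < τ0) :
    Tendsto (fun x => bval x σ0 τ0 μ0 μs / √x) atTop (𝓝 0) := by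
  have hfac : Tendsto (fun x : ℝ => 1 + σ0 ^ 2 / (x * τ0 ^ 2)) atTop (𝓝 (1 + 0)) :=
    ((tendsto_id.atTop_mul_const (by positivity)).const_div_atTop _).const_add 1
  have hlog := tendsto_log_one_add_mul_div (k := τ0 ^ 2 / σ0 ^ 2) (by positivity)
  have hconst : Tendsto (fun x : ℝ => (μs - μ0) ^ 2 / τ0 ^ 2 / x) atTop (𝓝 0) :=
    tendsto_id.const_div_atTop _
  have h := (hfac.mul (hlog.add hconst)).sqrt
  rw [add_zero, add_zero, mul_zero, Real.sqrt_zero] at h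
  refine h.congr' ?_
  filter_upwards [eventually_gt_atTop 0] with x hx
  rw [bval, ← Real.sqrt_div' _ hx.le, mul_div_assoc, add_div,
    show τ0 ^ 2 / σ0 ^ 2 * x = x * τ0 ^ 2 / σ0 ^ 2 by ring]

/-- `c + s b`, divided by `√n`, converges to the standardized distance `(μ* - μ) / σ₀`. -/
theorem tendsto_cval_add_mul_bval_div_sqrt (σ0 τ0 μ0 μs μ s : ℝ) (hσ0 : 0 < σ0) (hτ0 : 0 < τ0) :
    Tendsto (fun x => (cval x σ0 τ0 μ0 μs μ + s * bval x σ0 τ0 μ0 μs) / √x) atTop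
      (𝓝 ((μs - μ) / σ0)) := by
  have h := (((tendsto_aval_size σ0 τ0 μ0 μs hτ0).div_atTop Real.tendsto_sqrt_atTop).const_add
    ((μs - μ) / σ0)).add ((tendsto_bval_div_sqrt_size σ0 τ0 μ0 μs hσ0 hτ0).const_mul s)
  rw [mul_zero, add_zero, add_zero] at h
  refine h.congr' ?_
  filter_upwards [eventually_gt_atTop 0] with x hx
  have : √x ≠ 0 := (Real.sqrt_pos.2 hx).ne'
  rw [cval]
  field_simp

theorem tendsto_biasFavor_prior (n σ0 μ0 μs μ : ℝ) (hn : 0 < n) (hσ0 : 0 < σ0) :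
    Tendsto (fun τ0 => biasFavor n σ0 τ0 μ0 μs μ) atTop (𝓝 1) := by
  have hc : Tendsto (fun τ0 => cval n σ0 τ0 μ0 μs μ) atTop (𝓝 (√n * (μs - μ) / σ0 + 0)) :=
    (tendsto_aval_prior n σ0 μ0 μs hn).const_add _
  have hb := tendsto_bval_prior n σ0 μ0 μs hn hσ0
  have h := (tendsto_Phi_atTop_s17.comp (hc.add_atTop hb)).sub
    (tendsto_Phi_atBot_s17.comp (hc.add_atBot (tendsto_neg_atTop_atBot.comp hb)))
  rw [sub_zero] at h
  exact h

theorem tendsto_biasFavor_size (σ0 τ0 μ0 μs μ : ℝ) (hσ0 : 0 < σ0) (hτ0 : 0 < τ0) (hμ : μ ≠ μs) :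
    Tendsto (fun x => biasFavor x σ0 τ0 μ0 μs μ) atTop (𝓝 0) := by
  have hcongr (s : ℝ) : (fun x => (cval x σ0 τ0 μ0 μs μ + s * bval x σ0 τ0 μ0 μs) / √x * √x)
      =ᶠ[atTop] fun x => cval x σ0 τ0 μ0 μs μ + s * bval x σ0 τ0 μ0 μs := by
    filter_upwards [eventually_gt_atTop 0] with x hx
    exact div_mul_cancel₀ _ (Real.sqrt_pos.2 hx).ne'
  have hlim (s : ℝ) := tendsto_cval_add_mul_bval_div_sqrt σ0 τ0 μ0 μs μ s hσ0 hτ0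
  have hbias (x : ℝ) : Phi (cval x σ0 τ0 μ0 μs μ + 1 * bval x σ0 τ0 μ0 μs) -
      Phi (cval x σ0 τ0 μ0 μs μ + -1 * bval x σ0 τ0 μ0 μs) = biasFavor x σ0 τ0 μ0 μs μ := by
    rw [biasFavor, one_mul, neg_one_mul, ← sub_eq_add_neg]
  rcases lt_or_gt_of_ne hμ with hlt | hgt
  · have hd : 0 < (μs - μ) / σ0 := div_pos (sub_pos.2 hlt) hσ0
    have hP (s : ℝ) := tendsto_Phi_atTop_s17.comp
      (((hlim s).pos_mul_atTop hd Real.tendsto_sqrt_atTop).congr' (hcongr s))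
    have h := (hP 1).sub (hP (-1))
    rw [sub_self] at h
    exact h.congr hbias
  · have hd : (μs - μ) / σ0 < 0 := div_neg_of_neg_of_pos (sub_neg.2 hgt) hσ0
    have hP (s : ℝ) := tendsto_Phi_atBot_s17.comp
      (((hlim s).neg_mul_atTop hd Real.tendsto_sqrt_atTop).congr' (hcongr s))
    have h := (hP 1).sub (hP (-1))
    rw [sub_self] at h
    exact h.congr hbias

/-- **Limits of the bias in favor** (Evans–Guo, Example 1): (i) for fixed `n ≥ 1`, the bias
in favor `Φ(c + b) − Φ(c − b)` tends to `1` as `τ0 → ∞` (an arbitrarily diffuse prior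
produces bias in favor approaching certainty); (ii) for fixed `τ0 > 0` and `μ ≠ μ*`, it
tends to `0` as `n → ∞`. -/
theorem bias_in_favor_limits
    (σ0 μ0 μs μ : ℝ) (hσ0 : 0 < σ0) :
    (∀ n : ℕ, 1 ≤ n →
      Filter.Tendsto (fun τ0 : ℝ => biasFavor n σ0 τ0 μ0 μs μ) Filter.atTop (nhds 1)) ∧
    (∀ τ0 : ℝ, 0 < τ0 → μ ≠ μs →
      Filter.Tendsto (fun n : ℕ => biasFavor n σ0 τ0 μ0 μs μ) Filter.atTop (nhds 0)) := by
  refine ⟨fun n hn => ?_, fun τ0 hτ0 hμ => ?_⟩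
  · exact tendsto_biasFavor_prior n σ0 μ0 μs μ (by exact_mod_cast hn) hσ0
  · exact (tendsto_biasFavor_size σ0 τ0 μ0 μs μ hσ0 hτ0 hμ).comp tendsto_natCast_atTop_atTop
end
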